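/- Let X be a simple graph as in the context, let α = (M + √(M² + 4M))/2, and define bounded operators B_m by B_m = C_m for m = 0,1,2 and B_m = C_m − (Q_X − I)·Σ_{j=1}^{⌊m/2⌋} C_{m−2j} for m ≥ 3. Then for every complex number u with |u| < 1/α, (Σ_{m=1}^{∞} B_m u^m)(I − uA_X + u²Q_X) = A_X u − 2Q_X u² + (Q_X − I)(I − uA_X + u²Q_X)u². -/

import Mathlib

noncomputable section

/-- The Hilbert space `ℓ²(V)` of square-summable complex functions on `V`. -/
abbrev ℓ2 (V : Type) : Type := lp (fun _ : V => ℂ) 2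

namespace SimpleGraph

variable {V : Type} (G : SimpleGraph V)

/-- The degree of a vertex. -/
def gdeg (v : V) : ℕ := Nat.card (G.neighborSet v)

/-- A geodesic (non-backtracking) path of length `m` in a simple graph,
encoded as its sequence of `m + 1` vertices. -/
def IsGeoPath {m : ℕ} (p : Fin (m + 1) → V) : Prop :=
  (∀ (i : ℕ) (h : i + 1 < m + 1), G.Adj (p ⟨i, by omega⟩) (p ⟨i + 1, h⟩)) ∧
  (∀ (i : ℕ) (h : i + 2 < m + 1), p ⟨i + 2, h⟩ ≠ p ⟨i, by omega⟩)

/-- The number of geodesic loops (closed non-backtracking paths) of length `m`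
at `x`. -/
def cLoop (m : ℕ) (x : V) : ℕ :=
  Nat.card {p : Fin (m + 1) → V // G.IsGeoPath p ∧ p 0 = x ∧ p (Fin.last m) = x}

/-- The formal combinatorial Laplacian applied to `cLoop m`:
`(Δ_X c_m)(x) = deg(x)·c_m(x) − Σ_{y ∼ x} c_m(y)`. -/
def lapc (m : ℕ) (x : V) : ℤ :=
  (G.gdeg x : ℤ) * G.cLoop m x - ∑ᶠ y ∈ G.neighborSet x, (G.cLoop m y : ℤ)

/-- The defining property of the geodesic-path-counting operators `C_m` on
`ℓ²(V)`: `(C_m f)(x) = Σ_c f(t(c))`, the sum over all geodesic paths `c` of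
length `m` starting at `x` (so `C₀ = I` and `C₁ = A_X`). -/
def IsGeoCountOp (C : ℕ → (ℓ2 V →L[ℂ] ℓ2 V)) : Prop :=
  ∀ (m : ℕ) (f : ℓ2 V) (x : V),
    C m f x =
      ∑ᶠ p : {p : Fin (m + 1) → V // G.IsGeoPath p ∧ p 0 = x}, f (p.1 (Fin.last m))

/-- The defining property of the adjacency operator on `ℓ²(V)`:
`(A f)(x) = Σ_{y ∼ x} f(y)`. -/
def IsAdjOp (A : ℓ2 V →L[ℂ] ℓ2 V) : Prop :=
  ∀ (f : ℓ2 V) (x : V), A f x = ∑ᶠ y ∈ G.neighborSet x, f y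

/-- The defining property of the valency operator on `ℓ²(V)`:
`(D f)(x) = deg(x)·f(x)`. -/
def IsValOp (D : ℓ2 V →L[ℂ] ℓ2 V) : Prop :=
  ∀ (f : ℓ2 V) (x : V), D f x = (G.gdeg x : ℂ) * f x

end SimpleGraph

/-- The positive root of `λ² = M λ + M`. -/
theorem sq_growthRoot {M : ℝ} (hM : 0 ≤ M) :
    ((M + Real.sqrt (M ^ 2 + 4 * M)) / 2) ^ 2 = M * ((M + Real.sqrt (M ^ 2 + 4 * M)) / 2) + M := by
  have h := Real.sq_sqrt (show 0 ≤ M ^ 2 + 4 * M by positivity)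
  linear_combination h / 4

theorem le_growthRoot {M : ℝ} (hM : 0 ≤ M) : M ≤ (M + Real.sqrt (M ^ 2 + 4 * M)) / 2 := by
  have h : M ≤ Real.sqrt (M ^ 2 + 4 * M) := Real.le_sqrt_of_sq_le (by linarith)
  linarith

section GeneratingSeries

variable {R : Type*} [NormedRing R]

/-- A sequence satisfying the recurrence of the geodesic path operators with coefficients of norm
at most `M` grows at most like `a ^ m`, where `a ≥ M` and `a ^ 2 = M * a + M`. -/
theorem norm_le_pow_of_geoRec {A Q D : R} {C : ℕ → R} {M a : ℝ}
    (hone : ‖(1 : R)‖ ≤ 1) (hMa : M ≤ a) (ha : a ^ 2 = M * a + M)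
    (hA : ‖A‖ ≤ M) (hQ : ‖Q‖ ≤ M) (hD : ‖D‖ ≤ M)
    (h0 : C 0 = 1) (h1 : C 1 = A) (h2 : C 2 = C 1 * A - D)
    (hrec : ∀ m, C (m + 3) = C (m + 2) * A - C (m + 1) * Q) (m : ℕ) : ‖C m‖ ≤ a ^ m := by
  have hM0 : 0 ≤ M := (norm_nonneg A).trans hA
  have ha0 : 0 ≤ a := hM0.trans hMa
  have hC1 : ‖C 1‖ ≤ a := by rw [h1]; exact hA.trans hMa
  have hC2 : ‖C 2‖ ≤ a ^ 2 := by
    calc ‖C 2‖ ≤ ‖C 1‖ * ‖A‖ + ‖D‖ := by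
          rw [h2]; exact (norm_sub_le _ _).trans (by gcongr; exact norm_mul_le _ _)
      _ ≤ a * M + M := by gcongr
      _ = a ^ 2 := by rw [ha]; ring
  have key : ∀ n, ‖C (n + 1)‖ ≤ a ^ (n + 1) ∧ ‖C (n + 2)‖ ≤ a ^ (n + 2) := by
    intro n
    induction n with
    | zero => simpa using ⟨hC1, hC2⟩
    | succ n ih =>
      refine ⟨ih.2, ?_⟩
      calc ‖C (n + 3)‖ ≤ ‖C (n + 2)‖ * ‖A‖ + ‖C (n + 1)‖ * ‖Q‖ := by
            rw [hrec]
            exact (norm_sub_le _ _).trans (add_le_add (norm_mul_le _ _) (norm_mul_le _ _))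
        _ ≤ a ^ (n + 2) * M + a ^ (n + 1) * M := by
            have := ih.1
            have := ih.2
            gcongr
        _ = a ^ (n + 3) := by
            rw [pow_add a n 3, pow_succ a 2, ha, pow_add a n 2, ha, pow_succ]
            linear_combination (- a ^ n * M) * ha
  cases m with
  | zero => simpa [h0] using hone
  | succ n => exact (key n).1

/-- The partial sums `∑_{1 ≤ j ≤ m / 2} C_{m - 2j}` satisfy a two-step recurrence. -/
theorem sum_Icc_half_add_two {E : Type*} [AddCommMonoid E] (C : ℕ → E) (m : ℕ) :
    ∑ j ∈ Finset.Icc 1 ((m + 2) / 2), C (m + 2 - 2 * j) =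
      C m + ∑ j ∈ Finset.Icc 1 (m / 2), C (m - 2 * j) := by
  have h : (m + 2) / 2 = m / 2 + 1 := by omega
  simp only [← Finset.Ico_succ_right_eq_Icc, Finset.sum_Ico_eq_sum_range]
  simp only [Nat.succ_eq_succ, Nat.succ_eq_add_one, h, Nat.add_sub_cancel]
  rw [Finset.sum_range_succ', add_comm]
  congr 1
  refine Finset.sum_congr rfl fun j _ => ?_
  congr 1
  omega

variable [NormedAlgebra ℂ R]

/-- The generating series of a sequence with the geodesic recurrence. -/
theorem tsum_geoRec_mul {A Q : R} {C : ℕ → R} {u : ℂ}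
    (h0 : C 0 = 1) (h1 : C 1 = A) (h2 : C 2 = C 1 * A - (Q + 1))
    (hrec : ∀ m, C (m + 3) = C (m + 2) * A - C (m + 1) * Q)
    (hs : Summable fun m => u ^ m • C m) :
    (∑' m, u ^ m • C m) * (1 - u • A + u ^ 2 • Q) = (1 - u ^ 2) • (1 : R) := by
  set F := ∑' m, u ^ m • C m with hF
  have e1 : ∑ i ∈ Finset.range 1, u ^ i • C i + ∑' m, u ^ (m + 1) • C (m + 1) = F :=
    hs.sum_add_tsum_nat_add 1
  have e2 : ∑ i ∈ Finset.range 2, u ^ i • C i + ∑' m, u ^ (m + 2) • C (m + 2) = F :=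
    hs.sum_add_tsum_nat_add 2
  have e3 : ∑ i ∈ Finset.range 3, u ^ i • C i + ∑' m, u ^ (m + 3) • C (m + 3) = F :=
    hs.sum_add_tsum_nat_add 3
  have s1 : Summable fun m => u ^ (m + 1) • C (m + 1) := (summable_nat_add_iff 1).2 hs
  have s2 : Summable fun m => u ^ (m + 2) • C (m + 2) := (summable_nat_add_iff 2).2 hs
  have key : ∑' m, u ^ (m + 3) • C (m + 3) =
      (∑' m, u ^ (m + 2) • C (m + 2)) * (u • A) - (∑' m, u ^ (m + 1) • C (m + 1)) * (u ^ 2 • Q) := by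
    rw [← s2.tsum_mul_right, ← s1.tsum_mul_right, ← (s2.mul_right _).tsum_sub (s1.mul_right _)]
    refine tsum_congr fun m => ?_
    rw [hrec, smul_sub, smul_mul_smul_comm, smul_mul_smul_comm]
    ring_nf
  rw [← eq_sub_iff_add_eq'] at e1 e2 e3
  rw [e1, e2, e3] at key
  simp only [Finset.sum_range_succ, Finset.sum_range_zero, h2, h0, h1] at key
  simp only [mul_add, mul_sub, sub_mul, add_mul, smul_add, smul_sub, sub_smul, smul_mul_assoc,
    mul_smul_comm, smul_smul, mul_one, one_mul, pow_zero, one_smul, zero_add, pow_one] at key ⊢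
  have := sub_eq_zero.2 key
  rw [← sub_eq_zero, ← this]
  simp only [← sq]
  abel

variable [CompleteSpace R]

theorem summable_smul_of_norm_le_pow {C : ℕ → R} {u : ℂ} {a : ℝ} (hua : ‖u‖ * a < 1)
    (ha : 0 ≤ a) (hC : ∀ m, ‖C m‖ ≤ a ^ m) : Summable fun m => u ^ m • C m := by
  refine Summable.of_norm_bounded (summable_geometric_of_lt_one (by positivity) hua) fun m => ?_
  rw [norm_smul, norm_pow, mul_pow]
  gcongr
  exact hC m

theorem summable_smul_sum_Icc_half {C : ℕ → R} {u : ℂ} {a : ℝ} (hua : ‖u‖ * a < 1)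
    (ha : 1 ≤ a) (hC : ∀ m, ‖C m‖ ≤ a ^ m) :
    Summable fun m => u ^ m • ∑ j ∈ Finset.Icc 1 (m / 2), C (m - 2 * j) := by
  have hr : ‖‖u‖ * a‖ < 1 := by rwa [Real.norm_of_nonneg (by positivity)]
  refine Summable.of_norm_bounded (summable_pow_mul_geometric_of_norm_lt_one 1 hr) fun m => ?_
  have hE : ‖∑ j ∈ Finset.Icc 1 (m / 2), C (m - 2 * j)‖ ≤ m * a ^ m := by
    calc ‖∑ j ∈ Finset.Icc 1 (m / 2), C (m - 2 * j)‖
        ≤ ∑ j ∈ Finset.Icc 1 (m / 2), a ^ m :=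
          norm_sum_le_of_le _ fun j _ => (hC _).trans (pow_le_pow_right₀ ha (Nat.sub_le _ _))
      _ = (m / 2 : ℕ) * a ^ m := by simp
      _ ≤ m * a ^ m := by gcongr; exact Nat.div_le_self _ _
  rw [norm_smul, norm_pow, mul_pow, pow_one, mul_left_comm]
  gcongr

/-- The generating series of `C_m - (Q - 1) ∑_{1 ≤ j ≤ m / 2} C_{m - 2j}`, where the correction
term is dropped for `m ≤ 2`. -/
theorem summable_and_tsum_corrected_geoRec_mul {A Q : R} {B C : ℕ → R} {u : ℂ} {a : ℝ}
    (hua : ‖u‖ * a < 1) (ha : 1 ≤ a) (hC : ∀ m, ‖C m‖ ≤ a ^ m)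
    (h0 : C 0 = 1) (h1 : C 1 = A) (h2 : C 2 = C 1 * A - (Q + 1))
    (hrec : ∀ m, C (m + 3) = C (m + 2) * A - C (m + 1) * Q)
    (hB_small : ∀ m, m ≤ 2 → B m = C m)
    (hB : ∀ m, 3 ≤ m →
      B m = C m - (Q - 1) * ∑ j ∈ Finset.Icc 1 (m / 2), C (m - 2 * j)) :
    Summable (fun m : ℕ => u ^ (m + 1) • B (m + 1)) ∧
      (∑' m : ℕ, u ^ (m + 1) • B (m + 1)) * (1 - u • A + u ^ 2 • Q) =
        u • A - (2 * u ^ 2) • Q + u ^ 2 • ((Q - 1) * (1 - u • A + u ^ 2 • Q)) := by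
  set E : ℕ → R := fun m => ∑ j ∈ Finset.Icc 1 (m / 2), C (m - 2 * j) with hE
  have E0 : E 0 = 0 := by simp [hE]
  have E1 : E 1 = 0 := by simp [hE]
  have Erec : ∀ m, E (m + 2) = C m + E m := sum_Icc_half_add_two C
  have sC : Summable fun m => u ^ m • C m :=
    summable_smul_of_norm_le_pow hua (zero_le_one.trans ha) hC
  have sE : Summable fun m => u ^ m • E m := summable_smul_sum_Icc_half hua ha hC
  have hF := tsum_geoRec_mul h0 h1 h2 hrec sC
  set F := ∑' m, u ^ m • C m
  set G := ∑' m, u ^ m • E m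
  set P := 1 - u • A + u ^ 2 • Q with hP
  have hG : (1 - u ^ 2) • G = u ^ 2 • F := by
    have e2 : ∑ i ∈ Finset.range 2, u ^ i • E i + ∑' m, u ^ (m + 2) • E (m + 2) = G :=
      sE.sum_add_tsum_nat_add 2
    have e : ∑' m, u ^ (m + 2) • E (m + 2) = u ^ 2 • (F + G) := by
      rw [← sC.tsum_add sE, ← (sC.add sE).tsum_const_smul]
      refine tsum_congr fun m => ?_
      rw [Erec, ← smul_add, smul_smul]
      ring_nf
    rw [e] at e2
    simp only [Finset.sum_range_succ, Finset.sum_range_zero, E0, E1, smul_zero, zero_add] at e2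
    rw [sub_smul, one_smul, sub_eq_iff_eq_add, ← smul_add, e2]
  have hu1 : (1 : ℂ) - u ^ 2 ≠ 0 := by
    intro h
    have h1 : ‖u‖ < 1 := by nlinarith [norm_nonneg u]
    have h2 : ‖u‖ ^ 2 = 1 := by rw [← norm_pow, ← sub_eq_zero.1 h, norm_one]
    nlinarith [norm_nonneg u]
  have hGP : G * P = u ^ 2 • (1 : R) := by
    have h : (1 - u ^ 2) • (G * P) = (1 - u ^ 2) • (u ^ 2 • (1 : R)) := by
      rw [← smul_mul_assoc, hG, smul_mul_assoc, hF, smul_comm]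
    exact smul_right_injective R hu1 h
  have hBsum : HasSum (fun m => u ^ (m + 1) • B (m + 1))
      ((F - 1) - (Q - 1) * G + u ^ 2 • (Q - 1)) := by
    have c : HasSum (fun m => u ^ (m + 1) • C (m + 1)) (F - 1) := by
      simpa [h0] using (hasSum_nat_add_iff' 1).2 sC.hasSum
    have e : HasSum (fun m => u ^ (m + 1) • E (m + 1)) G := by
      simpa [E0] using (hasSum_nat_add_iff' 1).2 sE.hasSum
    refine ((c.sub (e.mul_left (Q - 1))).add (hasSum_ite_eq 1 (u ^ 2 • (Q - 1)))).congr_fun ?_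
    intro m
    match m with
    | 0 => simp [hB_small, E1]
    | 1 => simp [hB_small, Erec 0, E0, h0]
    | m + 2 => simp [hB, smul_sub, hE]
  refine ⟨hBsum.summable, ?_⟩
  rw [hBsum.tsum_eq, add_mul, sub_mul, sub_mul, hF, one_mul, mul_assoc, hGP]
  have hA : u • A = 1 + u ^ 2 • Q - P := by rw [hP]; abel
  clear_value P
  rw [hA]
  simp only [sub_mul, smul_sub, sub_smul, smul_mul_assoc, mul_smul_comm, mul_one, one_mul,
    one_smul, two_mul, add_smul]
  abel

end GeneratingSeries

namespace SimpleGraph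

variable {V : Type} {G : SimpleGraph V}

open Classical in
/-- The vertices by which a path of length `m` can be prolonged without backtracking. -/
def geoExt (hfin : ∀ v : V, (G.neighborSet v).Finite) {m : ℕ} (p : Fin (m + 1) → V) : Finset V :=
  (hfin (p (Fin.last m))).toFinset.filter fun y => ∀ i : Fin (m + 1), (i : ℕ) + 1 = m → y ≠ p i

theorem mem_geoExt {hfin : ∀ v : V, (G.neighborSet v).Finite} {m : ℕ} {p : Fin (m + 1) → V}
    {y : V} : y ∈ geoExt hfin p ↔
      G.Adj (p (Fin.last m)) y ∧ ∀ i : Fin (m + 1), (i : ℕ) + 1 = m → y ≠ p i := by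
  simp [geoExt]

theorem isGeoPath_snoc (hfin : ∀ v : V, (G.neighborSet v).Finite) {m : ℕ} {p : Fin (m + 1) → V}
    {y : V} : G.IsGeoPath (Fin.snoc (α := fun _ => V) p y : Fin (m + 2) → V) ↔
      G.IsGeoPath p ∧ y ∈ geoExt hfin p := by
  have hlt : ∀ (i : ℕ) (h : i < m + 1) (h' : i < m + 2),
      (Fin.snoc (α := fun _ => V) p y : Fin (m + 2) → V) ⟨i, h'⟩ = p ⟨i, h⟩ := fun i h h' =>
    Fin.snoc_castSucc (α := fun _ => V) y p ⟨i, h⟩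
  have hlast : ∀ h' : m + 1 < m + 2,
      (Fin.snoc (α := fun _ => V) p y : Fin (m + 2) → V) ⟨m + 1, h'⟩ = y := fun _ =>
    Fin.snoc_last (α := fun _ => V) y p
  rw [mem_geoExt]
  constructor
  · rintro ⟨h1, h2⟩
    refine ⟨⟨fun i h => ?_, fun i h => ?_⟩, ?_, fun i hi => ?_⟩
    · have := h1 i (by omega)
      rwa [hlt i (by omega), hlt (i + 1) h] at this
    · have := h2 i (by omega)
      rwa [hlt i (by omega), hlt (i + 2) h] at this
    · have := h1 m (by omega)
      rwa [hlt m (by omega), hlast] at this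
    · obtain ⟨i, hi'⟩ := i
      obtain rfl : i + 1 = m := hi
      have := h2 i (by omega)
      rwa [hlt i hi', hlast] at this
  · rintro ⟨⟨h1, h2⟩, h3, h4⟩
    refine ⟨fun i h => ?_, fun i h => ?_⟩
    · rcases Nat.lt_or_ge (i + 1) (m + 1) with hi | hi
      · rw [hlt i (by omega), hlt (i + 1) hi]
        exact h1 i hi
      · obtain rfl : i = m := by omega
        rw [hlt i (by omega), hlast]
        exact h3
    · rcases Nat.lt_or_ge (i + 2) (m + 1) with hi | hi
      · rw [hlt i (by omega), hlt (i + 2) hi]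
        exact h2 i hi
      · obtain rfl : m = i + 1 := by omega
        rw [hlt i (by omega), hlast]
        exact h4 ⟨i, _⟩ rfl

open Classical in
/-- The geodesic paths of length `m` starting at `x`, in a locally finite graph. -/
def geoPaths (hfin : ∀ v : V, (G.neighborSet v).Finite) (x : V) :
    (m : ℕ) → Finset (Fin (m + 1) → V)
  | 0 => {fun _ => x}
  | m + 1 => (geoPaths hfin x m).biUnion fun p =>
      (geoExt hfin p).image fun y => (Fin.snoc (α := fun _ => V) p y : Fin (m + 2) → V)

theorem mem_geoPaths (hfin : ∀ v : V, (G.neighborSet v).Finite) {x : V} {m : ℕ}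
    {p : Fin (m + 1) → V} : p ∈ geoPaths hfin x m ↔ G.IsGeoPath p ∧ p 0 = x := by
  induction m with
  | zero =>
    simp only [geoPaths, Finset.mem_singleton]
    constructor
    · rintro rfl
      exact ⟨⟨fun i h => by omega, fun i h => by omega⟩, rfl⟩
    · rintro ⟨-, rfl⟩
      funext i
      exact congrArg p (Fin.fin_one_eq_zero i)
  | succ m ih =>
    have hs : p = (Fin.snoc (α := fun _ => V) (Fin.init p : Fin (m + 1) → V) (p (Fin.last _)) :
      Fin (m + 2) → V) := (Fin.snoc_init_self (α := fun _ => V) p).symm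
    have h0 : (Fin.init p : Fin (m + 1) → V) 0 = p 0 := rfl
    rw [← h0, hs, isGeoPath_snoc hfin, ← hs]
    simp only [geoPaths, Finset.mem_biUnion, Finset.mem_image]
    constructor
    · rintro ⟨q, hq, y, hy, rfl⟩
      simp only [Fin.init_snoc, Fin.snoc_last]
      exact ⟨⟨(ih.1 hq).1, hy⟩, (ih.1 hq).2⟩
    · rintro ⟨⟨h1, h2⟩, h3⟩
      exact ⟨_, ih.2 ⟨h1, h3⟩, _, h2, hs.symm⟩

/-- Summing over geodesic paths by splitting off the last step. -/
theorem sum_geoPaths_succ (hfin : ∀ v : V, (G.neighborSet v).Finite) (x : V) (m : ℕ)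
    (g : (Fin (m + 2) → V) → ℂ) :
    ∑ p ∈ geoPaths hfin x (m + 1), g p =
      ∑ p ∈ geoPaths hfin x m, ∑ y ∈ geoExt hfin p, g (Fin.snoc (α := fun _ => V) p y) := by
  classical
  rw [geoPaths, Finset.sum_biUnion]
  · refine Finset.sum_congr rfl fun p _ => Finset.sum_image fun y _ z _ h => ?_
    exact (Fin.snoc_inj.1 h).2
  · intro p _ q _ hpq
    simp only [Function.onFun, Finset.disjoint_left, Finset.mem_image]
    rintro _ ⟨y, _, rfl⟩ ⟨z, _, h⟩
    exact hpq (Fin.snoc_inj.1 h).1.symm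

theorem gdeg_eq_card (hfin : ∀ v : V, (G.neighborSet v).Finite) (v : V) :
    G.gdeg v = (hfin v).toFinset.card := by
  rw [gdeg, Nat.card_coe_set_eq, Set.ncard_eq_toFinset_card _ (hfin v)]

/-- All neighbours of the endpoint of a path of positive length are non-backtracking prolongations,
except for the penultimate vertex. -/
theorem sum_geoExt_add {hfin : ∀ v : V, (G.neighborSet v).Finite} {m : ℕ} {p : Fin (m + 2) → V}
    (hp : G.IsGeoPath p) (g : V → ℂ) :
    ∑ y ∈ geoExt hfin p, g y + g (p (Fin.last m).castSucc) =
      ∑ y ∈ (hfin (p (Fin.last (m + 1)))).toFinset, g y := by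
  classical
  have hprev : p (Fin.last m).castSucc ∈ (hfin (p (Fin.last (m + 1)))).toFinset := by
    rw [Set.Finite.mem_toFinset, mem_neighborSet]
    exact (hp.1 m (by omega)).symm
  have hext : geoExt hfin p =
      (hfin (p (Fin.last (m + 1)))).toFinset.erase (p (Fin.last m).castSucc) := by
    ext y
    simp only [mem_geoExt, Finset.mem_erase, Set.Finite.mem_toFinset, mem_neighborSet]
    rw [and_comm]
    refine and_congr_left fun _ => ⟨fun h => h _ rfl, fun h i hi => ?_⟩
    rwa [show i = (Fin.last m).castSucc from Fin.ext (by simpa using hi)]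
  rw [hext, Finset.sum_erase_add _ _ hprev]

theorem sum_geoExt_zero {hfin : ∀ v : V, (G.neighborSet v).Finite} (p : Fin 1 → V) (g : V → ℂ) :
    ∑ y ∈ geoExt hfin p, g y = ∑ y ∈ (hfin (p 0)).toFinset, g y := by
  refine Finset.sum_congr ?_ fun _ _ => rfl
  ext y
  simp [mem_geoExt]

section Operators

variable {A D : ℓ2 V →L[ℂ] ℓ2 V} {C : ℕ → (ℓ2 V →L[ℂ] ℓ2 V)}

theorem IsAdjOp.apply_eq_sum (hA : G.IsAdjOp A) (hfin : ∀ v : V, (G.neighborSet v).Finite)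
    (f : ℓ2 V) (x : V) : A f x = ∑ y ∈ (hfin x).toFinset, f y := by
  rw [hA, finsum_mem_eq_finite_toFinset_sum _ (hfin x)]

theorem IsGeoCountOp.apply_eq_sum (hC : G.IsGeoCountOp C)
    (hfin : ∀ v : V, (G.neighborSet v).Finite) (m : ℕ) (f : ℓ2 V) (x : V) :
    C m f x = ∑ p ∈ geoPaths hfin x m, f (p (Fin.last m)) := by
  rw [hC]
  have h := finsum_set_coe_eq_finsum_mem (f := fun p : Fin (m + 1) → V => f (p (Fin.last m)))
    {p : Fin (m + 1) → V | G.IsGeoPath p ∧ p 0 = x}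
  refine h.trans ?_
  rw [← finsum_mem_coe_finset]
  refine finsum_mem_congr (Set.ext fun p => ?_) fun _ _ => rfl
  simp [mem_geoPaths]

theorem IsGeoCountOp.apply_succ (hC : G.IsGeoCountOp C)
    (hfin : ∀ v : V, (G.neighborSet v).Finite) (m : ℕ) (f : ℓ2 V) (x : V) :
    C (m + 1) f x = ∑ p ∈ geoPaths hfin x m, ∑ y ∈ geoExt hfin p, f y := by
  rw [hC.apply_eq_sum hfin, sum_geoPaths_succ]
  simp only [Fin.snoc_last]

theorem IsGeoCountOp.zero_eq_one (hC : G.IsGeoCountOp C)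
    (hfin : ∀ v : V, (G.neighborSet v).Finite) : C 0 = 1 := by
  ext f x
  rw [hC.apply_eq_sum hfin]
  simp [geoPaths]

theorem IsGeoCountOp.one_eq_adj (hC : G.IsGeoCountOp C) (hA : G.IsAdjOp A)
    (hfin : ∀ v : V, (G.neighborSet v).Finite) : C 1 = A := by
  ext f x
  rw [hC.apply_succ hfin, hA.apply_eq_sum hfin]
  simp [geoPaths, sum_geoExt_zero]

/-- Prolonging a geodesic path by an arbitrary edge either gives a geodesic path or backtracks. -/
theorem IsGeoCountOp.mul_adj_apply (hC : G.IsGeoCountOp C) (hA : G.IsAdjOp A)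
    (hfin : ∀ v : V, (G.neighborSet v).Finite) (m : ℕ) (f : ℓ2 V) (x : V) :
    (C (m + 1) * A) f x = C (m + 2) f x +
      ∑ p ∈ geoPaths hfin x m, ((geoExt hfin p).card : ℂ) * f (p (Fin.last m)) := by
  have hb : ∑ p ∈ geoPaths hfin x m, ((geoExt hfin p).card : ℂ) * f (p (Fin.last m)) =
      ∑ p ∈ geoPaths hfin x (m + 1), f (p (Fin.last m).castSucc) := by
    rw [sum_geoPaths_succ]
    simp only [Fin.snoc_castSucc, Finset.sum_const, nsmul_eq_mul]
  rw [hb, hC.apply_succ hfin (m + 1), ← Finset.sum_add_distrib, mul_apply_eq_comp,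
    hC.apply_eq_sum hfin]
  refine Finset.sum_congr rfl fun p hp => ?_
  rw [hA.apply_eq_sum hfin, sum_geoExt_add ((mem_geoPaths hfin).1 hp).1 (fun y => f y)]

theorem IsGeoCountOp.two_eq (hC : G.IsGeoCountOp C) (hA : G.IsAdjOp A) (hD : G.IsValOp D)
    (hfin : ∀ v : V, (G.neighborSet v).Finite) : C 2 = C 1 * A - D := by
  rw [eq_sub_iff_add_eq]
  ext f x
  rw [hC.mul_adj_apply hA hfin, add_apply, lp.coeFn_add, Pi.add_apply, hD]
  have h := sum_geoExt_zero (hfin := hfin) (fun _ => x) 1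
  simp only [Pi.one_apply, Finset.sum_const, nsmul_eq_mul, mul_one] at h
  simp [geoPaths, h, gdeg_eq_card hfin]

theorem IsGeoCountOp.add_three_eq (hC : G.IsGeoCountOp C) (hA : G.IsAdjOp A) (hD : G.IsValOp D)
    (hfin : ∀ v : V, (G.neighborSet v).Finite) (m : ℕ) :
    C (m + 3) = C (m + 2) * A - C (m + 1) * (D - 1) := by
  rw [eq_sub_iff_add_eq]
  ext f x
  rw [hC.mul_adj_apply hA hfin, add_apply, lp.coeFn_add, Pi.add_apply,
    mul_apply_eq_comp, hC.apply_eq_sum hfin (m + 1)]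
  congr 1
  refine Finset.sum_congr rfl fun p hp => ?_
  have h := sum_geoExt_add (hfin := hfin) ((mem_geoPaths hfin).1 hp).1 1
  simp only [Pi.one_apply, Finset.sum_const, nsmul_eq_mul, mul_one] at h
  rw [sub_apply, lp.coeFn_sub, Pi.sub_apply, hD, gdeg_eq_card hfin, ← h,
    one_apply_eq_self]
  ring

theorem norm_lp_two_le {f g : ℓ2 V} {M : ℝ} (hM : 0 ≤ M)
    (h : ∀ s : Finset V, ∑ x ∈ s, ‖g x‖ ^ 2 ≤ (M * ‖f‖) ^ 2) : ‖g‖ ≤ M * ‖f‖ := by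
  refine lp.norm_le_of_forall_sum_le (by simp) (by positivity) fun s => ?_
  simpa using h s

theorem sum_sq_le_norm_sq (f : ℓ2 V) (s : Finset V) : ∑ x ∈ s, ‖f x‖ ^ 2 ≤ ‖f‖ ^ 2 := by
  simpa using lp.sum_rpow_le_norm_rpow (p := 2) (by simp) f s

theorem norm_le_of_apply_eq_mul {T : ℓ2 V →L[ℂ] ℓ2 V} {c : V → ℂ} {M : ℝ} (hM : 0 ≤ M)
    (hT : ∀ f x, T f x = c x * f x) (hc : ∀ x, ‖c x‖ ≤ M) : ‖T‖ ≤ M := by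
  refine T.opNorm_le_bound hM fun f => norm_lp_two_le hM fun s => ?_
  calc ∑ x ∈ s, ‖T f x‖ ^ 2 ≤ ∑ x ∈ s, M ^ 2 * ‖f x‖ ^ 2 := by
        refine Finset.sum_le_sum fun x _ => ?_
        rw [hT, norm_mul, mul_pow]
        gcongr
        exact hc x
    _ ≤ (M * ‖f‖) ^ 2 := by
        rw [← Finset.mul_sum, mul_pow]
        gcongr
        exact sum_sq_le_norm_sq f s

theorem IsAdjOp.norm_le (hA : G.IsAdjOp A) (hfin : ∀ v : V, (G.neighborSet v).Finite) {M : ℕ}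
    (hM : ∀ v, G.gdeg v ≤ M) : ‖A‖ ≤ M := by
  classical
  simp only [gdeg_eq_card hfin] at hM
  refine A.opNorm_le_bound (by positivity) fun f => norm_lp_two_le (by positivity) fun s => ?_
  set t : Finset V := s.biUnion fun x => (hfin x).toFinset with ht
  calc ∑ x ∈ s, ‖A f x‖ ^ 2
      ≤ ∑ x ∈ s, (M : ℝ) * ∑ y ∈ (hfin x).toFinset, ‖f y‖ ^ 2 := by
        refine Finset.sum_le_sum fun x _ => ?_
        rw [hA.apply_eq_sum hfin]
        calc ‖∑ y ∈ (hfin x).toFinset, f y‖ ^ 2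
            ≤ (∑ y ∈ (hfin x).toFinset, ‖f y‖) ^ 2 := by gcongr; exact norm_sum_le _ _
          _ ≤ ((hfin x).toFinset.card : ℝ) * ∑ y ∈ (hfin x).toFinset, ‖f y‖ ^ 2 :=
              sq_sum_le_card_mul_sum_sq
          _ ≤ M * ∑ y ∈ (hfin x).toFinset, ‖f y‖ ^ 2 := by
              gcongr
              exact hM x
    _ = M * ∑ y ∈ t, ∑ x ∈ s with G.Adj x y, ‖f y‖ ^ 2 := by
        rw [← Finset.mul_sum]
        congr 1
        refine Finset.sum_comm' fun x y => ?_
        simp only [ht, Set.Finite.mem_toFinset, mem_neighborSet, Finset.mem_filter,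
          Finset.mem_biUnion]
        exact ⟨fun h => ⟨h, x, h⟩, fun h => h.1⟩
    _ ≤ M * ∑ y ∈ t, (M : ℝ) * ‖f y‖ ^ 2 := by
        gcongr with y
        rw [Finset.sum_const, nsmul_eq_mul]
        gcongr
        refine (Finset.card_le_card fun x hx => ?_).trans (hM y)
        simpa using (Finset.mem_filter.1 hx).2.symm
    _ ≤ (M * ‖f‖) ^ 2 := by
        rw [← Finset.mul_sum, ← mul_assoc, ← sq, mul_pow]
        gcongr
        exact sum_sq_le_norm_sq f t

theorem IsValOp.norm_le (hD : G.IsValOp D) {M : ℕ} (hM : ∀ v, G.gdeg v ≤ M) : ‖D‖ ≤ M :=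
  norm_le_of_apply_eq_mul (by positivity) hD fun x => by simpa using hM x

theorem IsValOp.norm_sub_one_le (hD : G.IsValOp D) {M : ℕ} (hM1 : 1 ≤ M)
    (hM : ∀ v, G.gdeg v ≤ M) : ‖D - 1‖ ≤ M := by
  refine norm_le_of_apply_eq_mul (c := fun x => (G.gdeg x : ℂ) - 1) (by positivity)
    (fun f x => ?_) fun x => ?_
  · rw [sub_apply, lp.coeFn_sub, Pi.sub_apply, hD,
      one_apply_eq_self]
    ring
  · have h1 : (1 : ℝ) ≤ M := by exact_mod_cast hM1
    have h2 : (G.gdeg x : ℝ) ≤ M := by exact_mod_cast hM x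
    have h3 : (0 : ℝ) ≤ G.gdeg x := by positivity
    rw [show (G.gdeg x : ℂ) - 1 = ((G.gdeg x - 1 : ℝ) : ℂ) by push_cast; rfl, Complex.norm_real,
      Real.norm_eq_abs, abs_le]
    constructor <;> linarith

end Operators

end SimpleGraph

/-- With `B_m = C_m` for `m ≤ 2` and
`B_m = C_m − (Q_X − I)Σ_{j=1}^{⌊m/2⌋} C_{m−2j}` for `m ≥ 3`, for `|u| < 1/α`:
`(Σ_{m≥1} B_m u^m)(I − uA_X + u²Q_X) = A_X u − 2Q_X u² + (Q_X − I)(I − uA_X + u²Q_X)u²`. -/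
theorem B_series_identity {V : Type} (G : SimpleGraph V) [Countable V]
    (hconn : G.Connected)
    (hfin : ∀ v : V, (G.neighborSet v).Finite)
    (hbd : ∃ M₀ : ℕ, ∀ v : V, G.gdeg v ≤ M₀)
    (hdeg1 : ∀ v : V, G.gdeg v ≠ 1)
    (M : ℕ) (hM : M = sSup (Set.range fun v : V => G.gdeg v))
    (A D : ℓ2 V →L[ℂ] ℓ2 V) (hA : G.IsAdjOp A) (hD : G.IsValOp D)
    (C : ℕ → (ℓ2 V →L[ℂ] ℓ2 V)) (hC : G.IsGeoCountOp C)
    (B : ℕ → (ℓ2 V →L[ℂ] ℓ2 V))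
    (hB_small : ∀ m : ℕ, m ≤ 2 → B m = C m)
    (hB : ∀ m : ℕ, 3 ≤ m →
      B m = C m - ((D - 1) - 1) * ∑ j ∈ Finset.Icc 1 (m / 2), C (m - 2 * j))
    (u : ℂ) (hu : ‖u‖ < 1 / (((M : ℝ) + Real.sqrt ((M : ℝ) ^ 2 + 4 * M)) / 2)) :
    Summable (fun m : ℕ => u ^ (m + 1) • B (m + 1)) ∧
      (∑' m : ℕ, u ^ (m + 1) • B (m + 1)) * (1 - u • A + u ^ 2 • (D - 1)) =
        u • A - (2 * u ^ 2) • (D - 1) +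
          u ^ 2 • (((D - 1) - 1) * (1 - u • A + u ^ 2 • (D - 1))) := by
  have hdeg : ∀ v, G.gdeg v ≤ M := by
    obtain ⟨M₀, hM₀⟩ := hbd
    intro v
    rw [hM]
    exact le_csSup ⟨M₀, by rintro _ ⟨w, rfl⟩; exact hM₀ w⟩ ⟨v, rfl⟩
  have hM1 : 1 ≤ M := by
    rcases Nat.eq_zero_or_pos M with h | h
    · rw [h] at hu
      norm_num at hu
      exact absurd hu (norm_nonneg u).not_gt
    · exact h
  have hM0 : (0 : ℝ) ≤ M := by positivity
  have hroot := sq_growthRoot hM0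
  have hMa := le_growthRoot hM0
  set a : ℝ := ((M : ℝ) + Real.sqrt ((M : ℝ) ^ 2 + 4 * M)) / 2
  have ha1 : 1 ≤ a := le_trans (by exact_mod_cast hM1) hMa
  have h0 := hC.zero_eq_one hfin
  have h1 := hC.one_eq_adj hA hfin
  have h2 := hC.two_eq hA hD hfin
  have hrec := hC.add_three_eq hA hD hfin
  have hCa := norm_le_pow_of_geoRec ContinuousLinearMap.norm_id_le hMa hroot
    (hA.norm_le hfin hdeg) (hD.norm_sub_one_le hM1 hdeg) (hD.norm_le hdeg) h0 h1 h2 hrec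
  exact summable_and_tsum_corrected_geoRec_mul ((lt_div_iff₀ (by linarith)).1 hu) ha1 hCa h0 h1
    (by rw [h2, sub_add_cancel]) hrec hB_small hB
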